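/- arXiv:1804.05137 — 4 statements merged into one kernel-verified Lean document; each statement's English description precedes it below -/
import Mathlib

section
/- Let q be a prime power and 1 ≤ s < t ≤ k. There exists a t × k matrix M over F_q such that (1) every set of t columns of M is linearly independent and (2) M has s rows whose corresponding s × k submatrix has every set of s of its columns linearly independent, if and only if there exists a linear MDS code of length k and dimension t over F_q which contains a linear MDS subcode of length k and dimension s over F_q. -/
/-- A linear MDS code of length `k` and dimension `d` over `F`: a `d`-dimensional
linear subspace of `F^k` in which every nonzero vector has Hamming weight at least
`k - d + 1`. -/
def IsLinearMDS (F : Type*) [Field F] [DecidableEq F] (k d : ℕ)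
    (C : Submodule F (Fin k → F)) : Prop :=
  Module.finrank F C = d ∧ ∀ x ∈ C, x ≠ 0 → k - d + 1 ≤ hammingNorm x

/-- The matrix condition in Stinson's construction of a linear AOA(s,t,k,q):
any `t` columns of `M` are linearly independent, and there are `s` rows of `M`
such that any `s` columns of the corresponding `s × k` submatrix are linearly
independent. -/
def IsLinearAOAMatrix (F : Type*) [Field F] (s t k : ℕ)
    (M : Fin t → Fin k → F) : Prop :=
  (∀ c : Fin t → Fin k, Function.Injective c →
    LinearIndependent F fun i : Fin t => fun r : Fin t => M r (c i)) ∧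
  (∃ e : Fin s → Fin t, Function.Injective e ∧
    ∀ c : Fin s → Fin k, Function.Injective c →
      LinearIndependent F fun i : Fin s => fun r : Fin s => M (e r) (c i))

/-- A vector of Hamming weight at most `k - d` vanishes on `d` distinct coordinates. -/
theorem exists_injective_forall_eq_zero {F : Type*} [Field F] [DecidableEq F] {k d : ℕ}
    (hdk : d ≤ k) {x : Fin k → F} (hx : hammingNorm x < k - d + 1) :
    ∃ c : Fin d → Fin k, Function.Injective c ∧ ∀ i, x (c i) = 0 := by
  have hcard : d ≤ (Finset.univ.filter fun i => x i = 0).card := by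
    have h := Finset.card_filter_add_card_filter_not (s := (Finset.univ : Finset (Fin k)))
      (fun i => x i = 0)
    rw [Finset.card_univ, Fintype.card_fin] at h
    change (Finset.univ.filter fun i => ¬ x i = 0).card < _ at hx
    omega
  obtain ⟨u, hu, hud⟩ := Finset.exists_subset_card_eq hcard
  refine ⟨u.orderEmbOfFin hud, (u.orderEmbOfFin hud).injective, fun i => ?_⟩
  exact (Finset.mem_filter.1 (hu (u.orderEmbOfFin_mem hud i))).2

/-- A vector vanishing on `d` distinct coordinates has Hamming weight at most `k - d`. -/
theorem hammingNorm_lt_of_forall_eq_zero {F : Type*} [Field F] [DecidableEq F] {k d : ℕ}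
    {x : Fin k → F} {c : Fin d → Fin k} (hc : Function.Injective c) (hx : ∀ i, x (c i) = 0) :
    hammingNorm x < k - d + 1 := by
  have h := Finset.card_filter_add_card_filter_not (s := (Finset.univ : Finset (Fin k)))
    (fun i => x i = 0)
  rw [Finset.card_univ, Fintype.card_fin] at h
  have hd : d ≤ (Finset.univ.filter fun i => x i = 0).card := by
    have hle := Finset.card_le_card
      (show Finset.univ.image c ⊆ Finset.univ.filter fun i => x i = 0 by
        intro j hj
        obtain ⟨i, -, rfl⟩ := Finset.mem_image.1 hj
        simpa using hx i)
    rwa [Finset.card_image_of_injective _ hc, Finset.card_univ, Fintype.card_fin] at hle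
  change (Finset.univ.filter fun i => ¬ x i = 0).card < _
  omega

/-- Square columns `fun i r => G r (c i)` are linearly independent exactly when no nontrivial
combination of the rows of `G` vanishes on all the coordinates `c i`. -/
theorem linearIndependent_columns_iff {F : Type*} [Field F] {k d : ℕ}
    (G : Fin d → Fin k → F) (c : Fin d → Fin k) :
    (LinearIndependent F fun i : Fin d => fun r : Fin d => G r (c i)) ↔
      ∀ v : Fin d → F, (∀ i, (∑ r, v r • G r) (c i) = 0) → v = 0 := by
  change LinearIndependent F (Matrix.of fun r i => G r (c i)).col ↔ _
  rw [Matrix.linearIndependent_cols_iff_isUnit, ← Matrix.linearIndependent_rows_iff_isUnit,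
    Fintype.linearIndependent_iff]
  simp only [funext_iff, Finset.sum_apply, Pi.smul_apply, Matrix.row_apply, Matrix.of_apply,
    Pi.zero_apply]

/-- A family of `d` vectors generates a `d`-dimensional MDS code exactly when any `d` columns of
the corresponding generator matrix are linearly independent. -/
theorem forall_linearIndependent_columns_iff_isLinearMDS_span {F : Type*} [Field F]
    [DecidableEq F] {k d : ℕ} (hdk : d ≤ k) (G : Fin d → Fin k → F) :
    (∀ c : Fin d → Fin k, Function.Injective c →
      LinearIndependent F fun i : Fin d => fun r : Fin d => G r (c i)) ↔
    IsLinearMDS F k d (Submodule.span F (Set.range G)) := by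
  simp only [linearIndependent_columns_iff]
  constructor
  · intro h
    have hli : LinearIndependent F G := by
      refine Fintype.linearIndependent_iff.2 fun v hv => congrFun ?_
      exact h (Fin.castLE hdk) (Fin.castLE_injective hdk) v fun i => by rw [hv, Pi.zero_apply]
    refine ⟨by rw [finrank_span_eq_card hli, Fintype.card_fin], fun x hx hx0 => ?_⟩
    obtain ⟨v, rfl⟩ := (Submodule.mem_span_range_iff_exists_fun F).1 hx
    by_contra! hlt
    obtain ⟨c, hc, hz⟩ := exists_injective_forall_eq_zero hdk hlt
    exact hx0 (by simp [h c hc v hz])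
  · rintro ⟨hfin, hwt⟩ c hc v hv
    have hli : LinearIndependent F G :=
      linearIndependent_iff_card_eq_finrank_span.2 (by rw [Fintype.card_fin]; exact hfin.symm)
    have hmem : ∑ r, v r • G r ∈ Submodule.span F (Set.range G) :=
      (Submodule.mem_span_range_iff_exists_fun F).2 ⟨v, rfl⟩
    by_contra hv0
    refine (hwt _ hmem fun h0 => hv0 ?_).not_gt (hammingNorm_lt_of_forall_eq_zero hc hv)
    exact funext (Fintype.linearIndependent_iff.1 hli v h0)

/-- A finite-dimensional subspace is spanned by a family of `finrank` many vectors. -/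
theorem exists_span_range_eq_of_finrank_eq {F V : Type*} [Field F] [AddCommGroup V] [Module F V]
    {d : ℕ} (C : Submodule F V) [FiniteDimensional F C] (hC : Module.finrank F C = d) :
    ∃ G : Fin d → V, Submodule.span F (Set.range G) = C := by
  refine ⟨C.subtype ∘ Module.finBasisOfFinrankEq F C hC, ?_⟩
  rw [Set.range_comp, Submodule.span_image, Module.Basis.span_eq, Submodule.map_subtype_top]

/-- Nested subspaces are spanned by a family and a subfamily of the right sizes. -/
theorem exists_span_range_eq_of_le {F V : Type*} [Field F] [AddCommGroup V] [Module F V]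
    [FiniteDimensional F V] {s t : ℕ} {C' C : Submodule F V} (hle : C' ≤ C)
    (hC' : Module.finrank F C' = s) (hC : Module.finrank F C = t) :
    ∃ (M : Fin t → V) (e : Fin s → Fin t), Function.Injective e ∧
      Submodule.span F (Set.range fun r => M (e r)) = C' ∧
      Submodule.span F (Set.range M) = C := by
  obtain ⟨D, hD⟩ := C'.exists_isCompl
  have hsup : C' ⊔ D ⊓ C = C := by
    rw [← sup_inf_assoc_of_le D hle, hD.sup_eq_top, top_inf_eq]
  have hinf : C' ⊓ (D ⊓ C) = ⊥ := by rw [← inf_assoc, hD.inf_eq_bot, bot_inf_eq]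
  have hdim := Submodule.finrank_sup_add_finrank_inf_eq C' (D ⊓ C)
  rw [hsup, hinf, finrank_bot, add_zero, hC', hC] at hdim
  subst hdim
  obtain ⟨G, hG⟩ := exists_span_range_eq_of_finrank_eq C' hC'
  obtain ⟨H, hH⟩ := exists_span_range_eq_of_finrank_eq (D ⊓ C) rfl
  refine ⟨Fin.append G H, Fin.castAdd _, Fin.castAdd_injective _ _, ?_, ?_⟩
  · simpa only [Fin.append_left] using hG
  · have hrange : Set.range (Fin.append G H) = Set.range G ∪ Set.range H := by
      rw [← Set.Sum.elim_range, ← Fin.append_comp_sumElim]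
      exact (finSumFinEquiv.surjective.range_comp (Fin.append G H)).symm
    rw [hrange, Submodule.span_union, hG, hH, hsup]

theorem linear_aoa_iff_mds_pair (q s t k : ℕ) (F : Type*) [Field F] [Fintype F]
    [DecidableEq F] (hF : Fintype.card F = q)
    (hs : 1 ≤ s) (hst : s < t) (htk : t ≤ k) :
    (∃ M : Fin t → Fin k → F, IsLinearAOAMatrix F s t k M) ↔
    (∃ C' C : Submodule F (Fin k → F), C' ≤ C ∧
      IsLinearMDS F k s C' ∧ IsLinearMDS F k t C) := by
  have hsk : s ≤ k := hst.le.trans htk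
  constructor
  · rintro ⟨M, hM, e, -, hMe⟩
    refine ⟨Submodule.span F (Set.range fun r => M (e r)), Submodule.span F (Set.range M),
      Submodule.span_mono (Set.range_comp_subset_range e M), ?_, ?_⟩
    · exact (forall_linearIndependent_columns_iff_isLinearMDS_span hsk fun r => M (e r)).1 hMe
    · exact (forall_linearIndependent_columns_iff_isLinearMDS_span htk M).1 hM
  · rintro ⟨C', C, hle, hC', hC⟩
    obtain ⟨M, e, he, hspan', hspan⟩ := exists_span_range_eq_of_le hle hC'.1 hC.1
    refine ⟨M, ?_, e, he, ?_⟩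
    · exact (forall_linearIndependent_columns_iff_isLinearMDS_span htk M).2 (hspan ▸ hC)
    · exact (forall_linearIndependent_columns_iff_isLinearMDS_span hsk fun r => M (e r)).2
        (hspan' ▸ hC')
end

section
/- Let q be a prime power and 1 ≤ s < t ≤ k. If there exist linear subspaces C' ⊆ C of F_q^k with dim C' = s and dim C = t, such that every nonzero vector of C' has Hamming weight at least k−s+1 and every nonzero vector of C has Hamming weight at least k−t+1, then there exist linear subspaces D' ⊆ D of F_q^k with dim D' = k−t and dim D = k−s, such that every nonzero vector of D' has Hamming weight at least t+1 and every nonzero vector of D has Hamming weight at least s+1. (That is, the existence of a linear AOA(s,t,k,q) implies the existence of a linear AOA(k−t,k−s,k,q).) -/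
/-- The code dual to `C` with respect to the standard dot product on `F ^ k`. -/
def dualCode {F : Type*} [Field F] {k : ℕ} (C : Submodule F (Fin k → F)) :
    Submodule F (Fin k → F) :=
  LinearMap.BilinForm.orthogonal (dotProductBilin F F) C

section dualCode

variable {F : Type*} [Field F] {k : ℕ}

theorem mem_dualCode_iff {C : Submodule F (Fin k → F)} {y : Fin k → F} :
    y ∈ dualCode C ↔ ∀ x ∈ C, x ⬝ᵥ y = 0 :=
  Iff.rfl

theorem dualCode_anti {C C' : Submodule F (Fin k → F)} (h : C' ≤ C) :
    dualCode C ≤ dualCode C' :=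
  LinearMap.BilinForm.orthogonal_le h

theorem finrank_dualCode (C : Submodule F (Fin k → F)) :
    Module.finrank F (dualCode C) = k - Module.finrank F C := by
  have hB : (dotProductBilin F F : LinearMap.BilinForm F (Fin k → F)).Nondegenerate :=
    ⟨fun x hx => dotProduct_eq_zero x hx,
      fun x hx => dotProduct_eq_zero x fun y => (dotProduct_comm x y).trans (hx y)⟩
  exact (LinearMap.BilinForm.finrank_orthogonal hB C).trans (by rw [Module.finrank_fin_fun])

variable [DecidableEq F]

/-- An MDS code of dimension `d` takes arbitrary values on any `d` coordinates. -/
theorem IsLinearMDS.exists_mem_eqOn {d : ℕ} {C : Submodule F (Fin k → F)}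
    (hC : IsLinearMDS F k d C) {T : Finset (Fin k)} (hT : T.card = d) (v : Fin k → F) :
    ∃ x ∈ C, ∀ i ∈ T, x i = v i := by
  let res : C →ₗ[F] (T → F) := (LinearMap.funLeft F F ((↑) : T → Fin k)).comp C.subtype
  have hinj : Function.Injective res := by
    rw [← LinearMap.ker_eq_bot, LinearMap.ker_eq_bot']
    rintro ⟨x, hx⟩ hres
    by_contra hne
    have hx0 : x ≠ 0 := fun h => hne (Subtype.ext h)
    have hsub : Finset.univ.filter (fun i => x i ≠ 0) ⊆ Tᶜ := by
      intro i hi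
      rw [Finset.mem_compl]
      exact fun hiT => (Finset.mem_filter.mp hi).2 (congrFun hres ⟨i, hiT⟩)
    have hle : hammingNorm x ≤ k - d := by
      simpa [hammingNorm, Finset.card_compl, hT] using Finset.card_le_card hsub
    have := hC.2 x hx hx0
    omega
  have hdim : Module.finrank F C = Module.finrank F (T → F) := by
    simp [hC.1, hT]
  obtain ⟨⟨x, hx⟩, hres⟩ :=
    (LinearMap.injective_iff_surjective_of_finrank_eq_finrank hdim).mp hinj fun i => v i
  exact ⟨x, hx, fun i hi => congrFun hres ⟨i, hi⟩⟩

/-- The dual of an MDS code is an MDS code. -/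
theorem IsLinearMDS.dualCode {d : ℕ} {C : Submodule F (Fin k → F)}
    (hC : IsLinearMDS F k d C) : IsLinearMDS F k (k - d) (dualCode C) := by
  have hdk : d ≤ k := by simpa [hC.1] using C.finrank_le
  refine ⟨by rw [finrank_dualCode, hC.1], fun y hy hy0 => ?_⟩
  by_contra! hlt
  have hcard : (Finset.univ.filter fun i => y i ≠ 0).card ≤ d := by
    change hammingNorm y ≤ d
    omega
  obtain ⟨T, hsT, hT⟩ := Finset.exists_superset_card_eq hcard (by simpa using hdk)
  obtain ⟨j, hj⟩ := Function.ne_iff.mp hy0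
  obtain ⟨x, hx, hxT⟩ := hC.exists_mem_eqOn hT (Pi.single j 1)
  apply hj
  have hdot : x ⬝ᵥ y = Pi.single j 1 ⬝ᵥ y := by
    refine Finset.sum_congr rfl fun i _ => ?_
    by_cases hi : y i = 0
    · simp [hi]
    · rw [hxT i (hsT (by simpa using hi))]
  simpa [mem_dualCode_iff.mp hy x hx] using hdot.symm

end dualCode

theorem linear_aoa_dual (q s t k : ℕ) (F : Type*) [Field F] [Fintype F]
    [DecidableEq F] (hF : Fintype.card F = q)
    (hs : 1 ≤ s) (hst : s < t) (htk : t ≤ k)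
    (h : ∃ C' C : Submodule F (Fin k → F), C' ≤ C ∧
      IsLinearMDS F k s C' ∧ IsLinearMDS F k t C) :
    ∃ D' D : Submodule F (Fin k → F), D' ≤ D ∧
      IsLinearMDS F k (k - t) D' ∧ IsLinearMDS F k (k - s) D := by
  obtain ⟨C', C, hle, hC', hC⟩ := h
  exact ⟨dualCode C, dualCode C', dualCode_anti hle, hC.dualCode, hC'.dualCode⟩
end

section
/- Suppose q ≥ 3 is a prime power and s, t are integers with 1 ≤ s < t ≤ q and t−s ≥ 2. Then there exists a t × (q+1) matrix M over F_q such that every set of t columns of M is linearly independent and M has s rows whose corresponding s × (q+1) submatrix has every set of s of its columns linearly independent. (That is, a linear AOA(s,t,q+1,q) exists.) -/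
open Polynomial in
/-- Evaluation of polynomials of degree less than `n` at a point of the projective line: at an
affine point `x` the value is scaled by `u x`, and at infinity it is the coefficient of
`X ^ (n - 1)`. -/
noncomputable def projEval {F : Type*} [Field F] (n : ℕ) (u : F → F) : Option F → F[X] →ₗ[F] F
  | none => lcoeff F (n - 1)
  | some x => u x • leval x

open Polynomial in
theorem eq_zero_of_projEval_eq_zero {F : Type*} [Field F] {n : ℕ} {u : F → F}
    (hu : ∀ x, u x ≠ 0) {c : Fin n → Option F} (hc : Function.Injective c) {f : F[X]}
    (hf : f.degree < n) (h : ∀ i, projEval n u (c i) f = 0) : f = 0 := by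
  classical
  have hval : ∀ i x, c i = some x → f.eval x = 0 := by
    intro i x hi
    have := h i
    rw [hi] at this
    simpa [projEval, hu x] using this
  have hsome : ∀ i, c i ≠ none → c i = some ((c i).getD 0) := by
    intro i hi
    obtain ⟨x, hx⟩ := Option.ne_none_iff_exists'.mp hi
    simp [hx]
  have hinj : ∀ i j, c i ≠ none → c j ≠ none → (c i).getD 0 = (c j).getD 0 → i = j := by
    intro i j hi hj hij
    exact hc (by rw [hsome i hi, hsome j hj, hij])
  by_cases hnone : ∃ i, c i = none
  · obtain ⟨i₀, hi₀⟩ := hnone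
    have hne : ∀ i ∈ Finset.univ.erase i₀, c i ≠ none := by
      intro i hi hi'
      exact Finset.ne_of_mem_erase hi (hc (hi'.trans hi₀.symm))
    refine eq_zero_of_degree_lt_of_eval_index_eq_zero (s := Finset.univ.erase i₀)
      (v := fun i => (c i).getD 0) (fun i hi j hj => hinj i j (hne i hi) (hne j hj)) ?_
      fun i hi => hval i _ (hsome i (hne i hi))
    have hlead : f.coeff (n - 1) = 0 := by
      have := h i₀
      rwa [hi₀] at this
    rw [Finset.card_erase_of_mem (Finset.mem_univ _), Finset.card_univ, Fintype.card_fin]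
    rw [degree_lt_iff_coeff_zero] at hf ⊢
    intro k hk
    rcases hk.eq_or_lt with rfl | hk
    · exact hlead
    · exact hf k (by omega)
  · push Not at hnone
    exact eq_zero_of_degree_lt_of_eval_index_eq_zero (s := Finset.univ)
      (v := fun i => (c i).getD 0) (fun i _ j _ => hinj i j (hnone i) (hnone j)) (by simpa using hf)
      fun i _ => hval i _ (hsome i (hnone i))

open Polynomial in
theorem linearIndependent_projEval {F : Type*} [Field F] (S : Sequence F) {n : ℕ} {u : F → F}
    (hu : ∀ x, u x ≠ 0) {c : Fin n → Option F} (hc : Function.Injective c) :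
    LinearIndependent F fun i : Fin n => fun r : Fin n => projEval n u (c i) (S r) := by
  let A : Matrix (Fin n) (Fin n) F := Matrix.of fun i r => projEval n u (c i) (S r)
  suffices LinearIndependent F A.col from
    Matrix.linearIndependent_rows_iff_isUnit.mpr (Matrix.linearIndependent_cols_iff_isUnit.mp this)
  rw [Fintype.linearIndependent_iff]
  intro a ha
  have hzero : ∑ r, a r • S (r : ℕ) = 0 := by
    refine eq_zero_of_projEval_eq_zero hu hc ?_ fun i => ?_
    · rw [← mem_degreeLT]
      refine Submodule.sum_mem _ fun r _ => Submodule.smul_mem _ _ ?_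
      rw [mem_degreeLT, S.degree_eq]
      exact_mod_cast r.2
    · simpa [A, Matrix.col_apply] using congrFun ha i
  exact Fintype.linearIndependent_iff.mp
    (S.linearIndependent.comp _ Fin.val_injective) a hzero

open Polynomial in
theorem exists_monic_natDegree_eq_forall_eval_ne_zero (F : Type*) [Field F] [Finite F] {m : ℕ}
    (hm : 2 ≤ m) : ∃ g : F[X], g.Monic ∧ g.natDegree = m ∧ ∀ x, g.eval x ≠ 0 := by
  have hnot : ¬ Function.Surjective fun x : F => x ^ m - x ^ (m - 1) := by
    rw [← Finite.injective_iff_surjective]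
    intro h
    have h01 := @h 0 1 (by simp [show m ≠ 0 by omega, show m - 1 ≠ 0 by omega])
    exact zero_ne_one h01
  simp only [Function.Surjective, not_forall, not_exists] at hnot
  obtain ⟨b, hb⟩ := hnot
  have hdeg : (-(X ^ (m - 1) + C b) : F[X]).degree < m := by
    rw [degree_neg, degree_X_pow_add_C (by omega)]
    exact_mod_cast (by omega : m - 1 < m)
  refine ⟨X ^ m + -(X ^ (m - 1) + C b), monic_X_pow_add hdeg, ?_, fun x hx => hb x ?_⟩
  · exact natDegree_eq_of_degree_eq_some
      ((degree_add_eq_left_of_degree_lt (by rwa [degree_X_pow])).trans (degree_X_pow m))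
  · simp only [eval_add, eval_neg, eval_pow, eval_X, eval_C] at hx
    linear_combination hx

open Polynomial in
/-- The polynomials `1, X, …, X ^ (m - 1), g, g * X, g * X ^ 2, …` for `g` monic of degree `m`. -/
noncomputable def mulXPowSequence {F : Type*} [Field F] (g : F[X]) (hg : g.Monic) : Sequence F where
  elems' i := if i < g.natDegree then X ^ i else g * X ^ (i - g.natDegree)
  degree_eq' i := by
    split_ifs with h
    · exact degree_X_pow i
    · rw [degree_mul, degree_X_pow, degree_eq_natDegree hg.ne_zero]
      exact_mod_cast (by omega : g.natDegree + (i - g.natDegree) = i)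

open Polynomial in
theorem projEval_mul_X_pow {F : Type*} [Field F] {g : F[X]} (hg : g.Monic) {s i : ℕ} (hi : i < s)
    (p : Option F) :
    projEval (g.natDegree + s) 1 p (g * X ^ i) = projEval s (fun x => g.eval x) p (X ^ i) := by
  cases p with
  | some x => simp [projEval]
  | none =>
    simp only [projEval, lcoeff_apply, coeff_X_pow]
    rw [coeff_mul_X_pow', if_pos (by omega)]
    split_ifs with h
    · rw [show g.natDegree + s - 1 - i = g.natDegree by omega]
      exact hg
    · exact coeff_eq_zero_of_natDegree_lt (by omega)

theorem linear_aoa_s_t_qp1 (q s t : ℕ) (F : Type*) [Field F] [Fintype F]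
    (hF : Fintype.card F = q) (hq : 3 ≤ q)
    (hs : 1 ≤ s) (hst : s < t) (htq : t ≤ q) (hts : 2 ≤ t - s) :
    ∃ M : Fin t → Fin (q + 1) → F, IsLinearAOAMatrix F s t (q + 1) M := by
  classical
  obtain ⟨g, hg, hdeg, hroot⟩ := exists_monic_natDegree_eq_forall_eval_ne_zero F hts
  have ht : t = g.natDegree + s := by omega
  let φ : Fin (q + 1) ≃ Option F :=
    (Fintype.equivFinOfCardEq (by rw [Fintype.card_option, hF])).symm
  refine ⟨fun r j => projEval t 1 (φ j) (mulXPowSequence g hg r), fun c hc => ?_,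
    fun i => ⟨g.natDegree + i, by omega⟩, fun i j hij => ?_, fun c hc => ?_⟩
  · exact linearIndependent_projEval _ (fun _ => one_ne_zero) (φ.injective.comp hc)
  · simpa [Fin.ext_iff] using hij
  · let powers : Polynomial.Sequence F := ⟨fun i => Polynomial.X ^ i, Polynomial.degree_X_pow⟩
    convert linearIndependent_projEval powers hroot (φ.injective.comp hc) using 3 with i r
    simp only [mulXPowSequence, powers, Function.comp_apply]
    rw [if_neg (by omega), Nat.add_sub_cancel_left, ht]
    exact projEval_mul_X_pow hg r.2 _
end

section
/- Suppose q ≥ 4 is a power of 2. Then there exists a 3 × (q+2) matrix M over F_q such that every set of 3 columns of M is linearly independent and M has a row all of whose entries are nonzero. (That is, a linear AOA(1,3,q+2,q) exists.) -/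
/-- The conic `x ↦ (x² + x + a : x : 1)` over a field together with its two extra points; it is
indexed by `Option (Option F)`, where `some none` and `none` index the extra points. -/
def hyperovalPoint {F : Type*} [Field F] (a : F) : Option (Option F) → Fin 3 → F
  | some (some x) => ![x ^ 2 + x + a, x, 1]
  | some none => ![1, 1, 0]
  | none => ![1, 0, 0]

/-- In characteristic two, any three distinct points of the hyperoval are independent. -/
lemma linearIndependent_hyperovalPoint {F : Type*} [Field F] (h2 : (2 : F) = 0) (a : F)
    (c : Fin 3 → Option (Option F)) (hc : Function.Injective c) :
    LinearIndependent F fun i => hyperovalPoint a (c i) := by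
  apply Matrix.linearIndependent_rows_of_det_ne_zero
    (A := Matrix.of fun i => hyperovalPoint a (c i))
  have h01 : c 0 ≠ c 1 := hc.ne (by decide)
  have h02 : c 0 ≠ c 2 := hc.ne (by decide)
  have h12 : c 1 ≠ c 2 := hc.ne (by decide)
  rw [Matrix.det_fin_three]
  simp only [Matrix.of_apply]
  generalize c 0 = u at *
  generalize c 1 = v at *
  generalize c 2 = w at *
  rcases u with _ | _ | x <;> rcases v with _ | _ | y <;> rcases w with _ | _ | z <;>
    simp [hyperovalPoint] at h01 h02 h12 ⊢ <;> grind

/-- The map `x ↦ x² + x` on a finite field is not injective, hence some quadratic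
`x² + x + a` has no root. -/
lemma exists_forall_sq_add_self_add_ne_zero (F : Type*) [Field F] [Finite F]
    (h2 : (2 : F) = 0) : ∃ a : F, ∀ x : F, x ^ 2 + x + a ≠ 0 := by
  by_contra! h
  have hsurj : Function.Surjective fun x : F => x ^ 2 + x := fun a => by
    obtain ⟨x, hx⟩ := h (-a)
    exact ⟨x, by linear_combination hx⟩
  have h01 : (0 : F) = 1 := Finite.injective_iff_surjective.mpr hsurj
    (by linear_combination -h2)
  exact zero_ne_one h01

theorem linear_aoa_1_3_qp2 (q : ℕ) (F : Type*) [Field F] [Fintype F]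
    (hF : Fintype.card F = q) (hq2 : ∃ n : ℕ, q = 2 ^ n) (hq4 : 4 ≤ q) :
    ∃ M : Fin 3 → Fin (q + 2) → F,
      (∀ c : Fin 3 → Fin (q + 2), Function.Injective c →
        LinearIndependent F fun i : Fin 3 => fun r : Fin 3 => M r (c i)) ∧
      ∃ r : Fin 3, ∀ j : Fin (q + 2), M r j ≠ 0 := by
  obtain ⟨n, rfl⟩ := hq2
  have h2 : (2 : F) = 0 := by
    have h := FiniteField.cast_card_eq_zero F
    rw [hF] at h
    push_cast at h
    exact eq_zero_of_pow_eq_zero h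
  obtain ⟨a, ha⟩ := exists_forall_sq_add_self_add_ne_zero F h2
  let e : Fin (2 ^ n + 2) ≃ Option (Option F) :=
    (Fintype.equivFinOfCardEq (by simp [hF])).symm
  refine ⟨fun r j => hyperovalPoint a (e j) r,
    fun c hc => linearIndependent_hyperovalPoint h2 a (e ∘ c) (e.injective.comp hc),
    0, fun j => ?_⟩
  show hyperovalPoint a (e j) 0 ≠ 0
  rcases e j with _ | _ | x
  · simp [hyperovalPoint]
  · simp [hyperovalPoint]
  · simpa [hyperovalPoint] using ha x
end
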